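/- arXiv:1209.4683 — 6 statements merged into one kernel-verified Lean document; each statement's English description precedes it below -/
import Mathlib

section
/- Let Q be a positive integer, let c ∈ ℝ^Q with c ≠ 0, let C = cᵀc = ‖c‖², let P > 0, and let R = 2C·I_Q − c·cᵀ. Then there exists w ∈ ℝ^Q with w_i² ≤ P for all i and wᵀ R w = 2·C·Q·P if and only if there exists a subset S ⊆ {1,…,Q} such that ∑_{i∈S} c_i = (1/2)·∑_{i=1}^Q c_i. -/
open Matrix

theorem dotProduct_smul_one_sub_vecMulVec_mulVec {ι : Type*} [Fintype ι] [DecidableEq ι]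
    (a : ℝ) (c w : ι → ℝ) :
    w ⬝ᵥ (a • (1 : Matrix ι ι ℝ) - Matrix.vecMulVec c c).mulVec w =
      a * ∑ i, w i ^ 2 - (∑ i, w i * c i) ^ 2 := by
  have hw : w ⬝ᵥ w = ∑ i, w i ^ 2 := by simp [dotProduct, sq]
  rw [Matrix.sub_mulVec, Matrix.smul_mulVec, Matrix.one_mulVec, Matrix.vecMulVec_mulVec,
    dotProduct_sub, dotProduct_smul, hw, op_smul_eq_smul, dotProduct_smul, dotProduct_comm c w]
  simp [dotProduct, sq]

theorem sum_sign_mul_eq {ι : Type*} [Fintype ι] [DecidableEq ι] (S : Finset ι) (r : ℝ)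
    (c : ι → ℝ) :
    ∑ i, (if i ∈ S then r else -r) * c i = r * (2 * ∑ i ∈ S, c i - ∑ i, c i) := by
  have h : ∑ i ∈ S, c i = ∑ i, if i ∈ S then c i else 0 := by simp
  rw [h, Finset.mul_sum, ← Finset.sum_sub_distrib, Finset.mul_sum]
  refine Finset.sum_congr rfl fun i _ => ?_
  split_ifs <;> ring

/-- Core of the NP-hardness reduction (Proposition 1): with
`R = 2C·I_Q − c·cᵀ`, `C = ‖c‖²`, the maximum value `2CQP` is attained by some
`w` with `w_i² ≤ P` iff `c` admits an equal partition. -/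
theorem partition_iff_quadratic_max
    (Q : ℕ) (hQ : 0 < Q) (c : Fin Q → ℝ) (hc : c ≠ 0)
    (C : ℝ) (hC : C = ∑ i, c i ^ 2) (P : ℝ) (hP : 0 < P)
    (R : Matrix (Fin Q) (Fin Q) ℝ)
    (hR : R = (2 * C) • (1 : Matrix (Fin Q) (Fin Q) ℝ) - Matrix.vecMulVec c c) :
    (∃ w : Fin Q → ℝ, (∀ i, w i ^ 2 ≤ P) ∧ w ⬝ᵥ R.mulVec w = 2 * C * Q * P) ↔
      ∃ S : Finset (Fin Q), ∑ i ∈ S, c i = (1 / 2) * ∑ i, c i := by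
  have hCpos : 0 < C := by
    obtain ⟨i, hi⟩ := Function.ne_iff.mp hc
    rw [hC]
    exact Finset.sum_pos' (fun i _ => sq_nonneg _) ⟨i, Finset.mem_univ i, sq_pos_of_ne_zero hi⟩
  have hr : √P ^ 2 = P := Real.sq_sqrt hP.le
  have hr0 : √P ≠ 0 := (Real.sqrt_pos.mpr hP).ne'
  have hconst : ∑ _i : Fin Q, P = Q * P := by simp
  subst hR
  simp only [dotProduct_smul_one_sub_vecMulVec_mulVec]
  constructor
  · rintro ⟨w, hw, heq⟩
    have hle : ∑ i, w i ^ 2 ≤ Q * P := hconst ▸ Finset.sum_le_sum fun i _ => hw i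
    have hsum : ∑ i, w i ^ 2 = Q * P := by
      refine le_antisymm hle (le_of_mul_le_mul_left ?_ (by positivity : 0 < 2 * C))
      nlinarith [sq_nonneg (∑ i, w i * c i)]
    have hzero : ∑ i, w i * c i = 0 := by
      rw [hsum] at heq
      exact pow_eq_zero_iff two_ne_zero |>.mp (by linarith)
    have hall : ∀ i, w i ^ 2 = P := fun i =>
      (Finset.sum_eq_sum_iff_of_le fun i _ => hw i).mp (hsum.trans hconst.symm) i
        (Finset.mem_univ i)
    refine ⟨Finset.univ.filter fun i => w i = √P, ?_⟩
    have hsign : ∀ i, w i = if i ∈ Finset.univ.filter (fun i => w i = √P) then √P else -√P := by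
      intro i
      simp only [Finset.mem_filter, Finset.mem_univ, true_and]
      split_ifs with h
      · exact h
      · exact (sq_eq_sq_iff_eq_or_eq_neg.mp ((hall i).trans hr.symm)).resolve_left h
    rw [Finset.sum_congr rfl fun i _ => congrArg (· * c i) (hsign i), sum_sign_mul_eq] at hzero
    linarith [(mul_eq_zero.mp hzero).resolve_left hr0]
  · rintro ⟨S, hS⟩
    have hsq : ∀ i, (if i ∈ S then √P else -√P) ^ 2 = P := fun i => by
      split_ifs <;> simp [hr]
    refine ⟨fun i => if i ∈ S then √P else -√P, fun i => (hsq i).le, ?_⟩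
    simp only [hsq, hconst, sum_sign_mul_eq, hS]
    ring
end

section
/- Let R be an n×n complex positive definite (Hermitian) matrix and let P > 0. Suppose Y* is an n×n complex positive semidefinite matrix with (Y*)_{ii} ≤ P for all i, and suppose Y* is optimal, i.e., Re(trace(R·Y)) ≤ Re(trace(R·Y*)) for every positive semidefinite Y with Y_{ii} ≤ P for all i. Then (Y*)_{ii} = P for all i = 1,…,n. -/
open Matrix
open scoped ComplexOrder

/-- Second part of Claim 2: at an optimal solution `Y*` of the SDP relaxation
`max Re(tr(R·Y))` s.t. `Y ⪰ 0`, `Y_{ii} ≤ P`, all diagonal (power) constraints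
are tight, provided `R` is positive definite. -/
theorem sdp_power_constraints_tight
    (n : ℕ) (R Ystar : Matrix (Fin n) (Fin n) ℂ) (P : ℝ) (hP : 0 < P)
    (hR : R.PosDef) (hY : Ystar.PosSemidef)
    (hdiag : ∀ i, (Ystar i i).re ≤ P)
    (hopt : ∀ Y : Matrix (Fin n) (Fin n) ℂ, Y.PosSemidef →
      (∀ i, (Y i i).re ≤ P) →
      (Matrix.trace (R * Y)).re ≤ (Matrix.trace (R * Ystar)).re) :
    ∀ i, Ystar i i = (P : ℂ) := by
  intro i
  have him : (Ystar i i).im = 0 := (Complex.nonneg_iff.mp hY.diag_nonneg).2.symm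
  have hre : (Ystar i i).re = P := by
    refine le_antisymm (hdiag i) (not_lt.mp fun hlt => ?_)
    set c : ℝ := P - (Ystar i i).re with hc
    have hc_pos : 0 < c := sub_pos.mpr hlt
    have hpsd : (diagonal (Pi.single i (c : ℂ)) : Matrix (Fin n) (Fin n) ℂ).PosSemidef :=
      PosSemidef.diagonal (Pi.single_nonneg.mpr (by exact_mod_cast hc_pos.le))
    have hle := hopt _ (hY.add hpsd) fun j => by
      rcases eq_or_ne j i with rfl | hj
      · simp [hc]
      · simpa [hj] using hdiag j
    have htrace : (trace (R * diagonal (Pi.single i (c : ℂ)))).re = (R i i).re * c := by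
      simp [trace, mul_diagonal, Pi.single_apply]
    have hRi : 0 < (R i i).re := (Complex.pos_iff.mp hR.diag_pos).1
    rw [mul_add, trace_add, Complex.add_re, htrace] at hle
    linarith [mul_pos hRi hc_pos]
  exact Complex.ext (by simpa using hre) (by simpa using him)
end

section
/- Let M, Q be natural numbers, P ≥ 0, and let R and X₁ be M×M complex positive semidefinite matrices. Suppose there exists y : {1,…,M} → ℝ with ∑_{i=1}^M y_i = 2Q − M such that the diagonal entries of X₁ satisfy (X₁)_{ii} = P·(1/2 + (1/2)·y_i) for all i. Then Re(trace(R·X₁)) ≤ Q·P·λ_max(R), where λ_max(R) denotes the largest eigenvalue of the Hermitian matrix R. -/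
open Matrix
open scoped ComplexOrder

/-- The trace pairing of a Hermitian matrix with a positive semidefinite matrix is at most the
largest eigenvalue of the former times the trace of the latter. -/
theorem Matrix.IsHermitian.re_trace_mul_le_iSup_eigenvalues_mul
    {𝕜 n : Type*} [RCLike 𝕜] [Fintype n] [DecidableEq n] {A B : Matrix n n 𝕜}
    (hA : A.IsHermitian) (hB : B.PosSemidef) :
    RCLike.re (A * B).trace ≤ (⨆ i, hA.eigenvalues i) * RCLike.re B.trace := by
  set U : Matrix n n 𝕜 := (hA.eigenvectorUnitary : Matrix n n 𝕜) with hU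
  have hUU : U * star U = 1 := Unitary.coe_mul_star_self hA.eigenvectorUnitary
  have hY : (star U * B * U).PosSemidef := hB.conjTranspose_mul_mul_same U
  have htrB : B.trace = (star U * B * U).trace := by
    rw [trace_mul_cycle, hUU, one_mul]
  have htrAB : (A * B).trace =
      (diagonal (RCLike.ofReal ∘ hA.eigenvalues) * (star U * B * U)).trace := by
    conv_lhs => rw [hA.spectral_theorem, Unitary.conjStarAlgAut_apply]
    rw [← hU, mul_assoc, mul_assoc, trace_mul_comm]
    simp only [mul_assoc]
  rw [htrAB, htrB]
  simp only [trace, diag_apply, diagonal_mul, Function.comp_apply, map_sum, RCLike.re_ofReal_mul,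
    Finset.mul_sum]
  refine Finset.sum_le_sum fun i _ => mul_le_mul_of_nonneg_right ?_ ?_
  · exact le_ciSup (Set.finite_range _).bddAbove i
  · exact (RCLike.nonneg_iff.mp hY.diag_nonneg).1

/-- Composite upper bound (eqUpperBoundHX): if the diagonal of the PSD matrix
`X₁` satisfies `(X₁)_{ii} = P(1/2 + y_i/2)` with `∑ y_i = 2Q − M`, then
`Re(tr(R·X₁)) ≤ Q·P·λ_max(R)`. -/
theorem trace_upper_bound_QP_lambdaMax
    (M Q : ℕ) (P : ℝ) (hP : 0 ≤ P)
    (R X₁ : Matrix (Fin M) (Fin M) ℂ)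
    (hR : R.PosSemidef) (hX₁ : X₁.PosSemidef)
    (y : Fin M → ℝ) (hy : ∑ i, y i = 2 * (Q : ℝ) - (M : ℝ))
    (hdiag : ∀ i, X₁ i i = ((P * (1 / 2 + 1 / 2 * y i) : ℝ) : ℂ)) :
    (Matrix.trace (R * X₁)).re ≤ (Q : ℝ) * P * (⨆ i, hR.1.eigenvalues i) := by
  have htr : (Matrix.trace X₁).re = Q * P := by
    simp only [trace, diag_apply, hdiag, Complex.re_sum, Complex.ofReal_re]
    rw [← Finset.mul_sum, Finset.sum_add_distrib, ← Finset.mul_sum, hy]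
    simp only [Finset.sum_const, Finset.card_univ, Fintype.card_fin, nsmul_eq_mul]
    ring
  calc (Matrix.trace (R * X₁)).re
      ≤ (⨆ i, hR.1.eigenvalues i) * (Matrix.trace X₁).re :=
        hR.1.re_trace_mul_le_iSup_eigenvalues_mul hX₁
    _ = (Q : ℝ) * P * (⨆ i, hR.1.eigenvalues i) := by rw [htr, mul_comm]
end

section
/- Let M ≥ 1, Q ≤ M, P ≥ 0, and let R be an M×M complex positive semidefinite matrix. Let S ⊆ {1,…,M} with |S| = Q be such that Re(R_{jj}) ≤ Re(R_{ii}) for every i ∈ S and every j ∉ S. Then there exists a Q×Q complex positive semidefinite matrix Y with Y_{ii} ≤ P for all i such that Re(trace(R[S]·Y)) ≥ (Q·P/M)·Re(trace(R)), where R[S] denotes the principal submatrix of R indexed by S. In particular, the optimal value of the SDP max{Re(trace(R[S]·Y)) : Y ⪰ 0, Y_{ii} ≤ P for all i} is at least (Q·P/M)·Re(trace(R)). -/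
open Matrix
open scoped ComplexOrder

/-- If every value of `f` on `S` dominates every value off `S`, then the average of `f` over `S`
is at least its average over the whole type (in cross-multiplied form). -/
theorem Finset.card_mul_sum_univ_le_card_mul_sum {ι : Type*} [Fintype ι] [DecidableEq ι]
    (S : Finset ι) (f : ι → ℝ) (h : ∀ i ∈ S, ∀ j ∉ S, f j ≤ f i) :
    (S.card : ℝ) * ∑ i, f i ≤ (Fintype.card ι : ℝ) * ∑ i ∈ S, f i := by
  have hcompl : (S.card : ℝ) * ∑ j ∈ Sᶜ, f j ≤ (Sᶜ.card : ℝ) * ∑ i ∈ S, f i := by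
    calc (S.card : ℝ) * ∑ j ∈ Sᶜ, f j = ∑ i ∈ S, ∑ j ∈ Sᶜ, f j := by simp
      _ ≤ ∑ i ∈ S, ∑ _j ∈ Sᶜ, f i :=
        Finset.sum_le_sum fun i hi => Finset.sum_le_sum fun j hj =>
          h i hi j (Finset.mem_compl.mp hj)
      _ = (Sᶜ.card : ℝ) * ∑ i ∈ S, f i := by simp [Finset.mul_sum]
  have hcard : (Fintype.card ι : ℝ) = S.card + Sᶜ.card := by
    exact_mod_cast (Finset.card_add_card_compl S).symm
  rw [← Finset.sum_add_sum_compl S f, hcard]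
  linarith

/-- Lower bound (eqLowerBoundHX): choosing the group `S` of `Q` nodes with
largest diagonal channel entries, there is a feasible PSD matrix `Y` (namely
`P·I`) for the SDP relaxation whose objective is at least `(QP/M)·Re(tr R)`. -/
theorem sdp_lower_bound_on_selected_group
    (M Q : ℕ) (hM : 1 ≤ M) (hQM : Q ≤ M) (P : ℝ) (hP : 0 ≤ P)
    (R : Matrix (Fin M) (Fin M) ℂ) (hR : R.PosSemidef)
    (S : Finset (Fin M)) (hcard : S.card = Q)
    (hsel : ∀ i ∈ S, ∀ j ∉ S, (R j j).re ≤ (R i i).re) :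
    ∃ Y : Matrix {x // x ∈ S} {x // x ∈ S} ℂ, Y.PosSemidef ∧
      (∀ i, (Y i i).re ≤ P) ∧
      ((Q : ℝ) * P / (M : ℝ)) * (Matrix.trace R).re ≤
        (Matrix.trace (R.submatrix (Subtype.val : {x // x ∈ S} → Fin M)
          (Subtype.val : {x // x ∈ S} → Fin M) * Y)).re := by
  have hM0 : (0 : ℝ) < M := by exact_mod_cast hM
  refine ⟨(P : ℂ) • 1, Matrix.PosSemidef.one.smul (by exact_mod_cast hP), fun i => by simp, ?_⟩
  have havg := Finset.card_mul_sum_univ_le_card_mul_sum S (fun i => (R i i).re) hsel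
  rw [hcard, Fintype.card_fin] at havg
  have hobj : (Matrix.trace (R.submatrix (Subtype.val : {x // x ∈ S} → Fin M)
      (Subtype.val : {x // x ∈ S} → Fin M) * ((P : ℂ) • 1))).re =
      P * ∑ i ∈ S, (R i i).re := by
    simp [Matrix.trace, Finset.mul_sum, ← Finset.sum_coe_sort S fun i => (R i i).re]
  have htrace : (Matrix.trace R).re = ∑ i, (R i i).re := by simp [Matrix.trace]
  rw [hobj, htrace, div_mul_eq_mul_div, div_le_iff₀ hM0]
  linarith [mul_le_mul_of_nonneg_left havg hP]
end

section
/- Let n be a positive integer and let A be an n×n real symmetric positive definite matrix. Then there exist a real number t > 0 and an n×n real symmetric positive definite matrix X such that X − t·Diag(X) = A, where Diag(X) denotes the diagonal matrix whose diagonal entries are those of X. -/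
open Matrix

/-- Nonemptiness of the set 𝒯 in Appendix C: for any real symmetric positive
definite `A` there exist `t > 0` and a symmetric positive definite `X` with
`X − t·Diag(X) = A`. -/
theorem exists_t_X_diag_shift
    (n : ℕ) (hn : 0 < n) (A : Matrix (Fin n) (Fin n) ℝ)
    (hAsymm : A.IsSymm) (hA : A.PosDef) :
    ∃ (t : ℝ) (X : Matrix (Fin n) (Fin n) ℝ), 0 < t ∧ X.IsSymm ∧ X.PosDef ∧
      X - t • Matrix.diagonal (fun i => X i i) = A := by
  refine ⟨1 / 2, A + diagonal (fun i => A i i), by norm_num,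
    hAsymm.add (isSymm_diagonal _),
    hA.add (PosDef.diagonal fun i => hA.diag_pos), ?_⟩
  ext i j
  by_cases h : i = j
  · subst h
    simp
    ring
  · simp [h]
end

section
/- Let M, Q be natural numbers, P > 0, and let R be an M×M complex positive definite matrix. Consider pairs (X₀, X₁) where X₀ is a real symmetric positive semidefinite (M+1)×(M+1) matrix with (X₀)_{ii} = 1 for all i and trace(B₀·X₀) = 4Q (with B₀ = [[I_M, e],[eᵀ, M]], e the all-ones vector), and X₁ is an M×M complex positive semidefinite matrix whose diagonal entries satisfy (1/P)·(X₁)_{ii} ≤ 1/2 + (1/2)·(X₀)_{i,M+1} for all i = 1,…,M. If (X₀*, X₁*) maximizes Re(trace(R·X₁)) over all such pairs, then (1/P)·(X₁*)_{ii} = 1/2 + (1/2)·(X₀*)_{i,M+1} for all i = 1,…,M. -/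
open Matrix
open scoped ComplexOrder

/-- First part of Claim 2: at any optimal solution `(X₀*, X₁*)` of the SDP
relaxation (SDP1) with positive definite channel matrix `R`, all relaxed
per-node power constraints `(1/P)·X₁[i,i] ≤ 1/2 + (1/2)·X₀[i,M+1]` are tight.
The index `M+1` is modelled by the summand `Unit` in `Fin M ⊕ Unit`. -/
theorem sdp1_power_constraints_tight
    (M Q : ℕ) (P : ℝ) (hP : 0 < P)
    (R : Matrix (Fin M) (Fin M) ℂ) (hR : R.PosDef)
    (B0 : Matrix (Fin M ⊕ Unit) (Fin M ⊕ Unit) ℝ)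
    (hB0 : B0 = Matrix.fromBlocks (1 : Matrix (Fin M) (Fin M) ℝ)
      (Matrix.of fun _ _ => (1 : ℝ)) (Matrix.of fun _ _ => (1 : ℝ))
      (Matrix.of fun _ _ => (M : ℝ)))
    (X0 : Matrix (Fin M ⊕ Unit) (Fin M ⊕ Unit) ℝ)
    (X1 : Matrix (Fin M) (Fin M) ℂ)
    (hX0symm : X0.IsSymm) (hX0psd : X0.PosSemidef)
    (hX0diag : ∀ i, X0 i i = 1)
    (hX0tr : Matrix.trace (B0 * X0) = 4 * (Q : ℝ))
    (hX1psd : X1.PosSemidef)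
    (hfeas : ∀ i : Fin M, (1 / P) * (X1 i i).re ≤
      1 / 2 + 1 / 2 * X0 (Sum.inl i) (Sum.inr ()))
    (hopt : ∀ (Y0 : Matrix (Fin M ⊕ Unit) (Fin M ⊕ Unit) ℝ)
        (Y1 : Matrix (Fin M) (Fin M) ℂ),
      Y0.IsSymm → Y0.PosSemidef → (∀ i, Y0 i i = 1) →
      Matrix.trace (B0 * Y0) = 4 * (Q : ℝ) → Y1.PosSemidef →
      (∀ i : Fin M, (1 / P) * (Y1 i i).re ≤
        1 / 2 + 1 / 2 * Y0 (Sum.inl i) (Sum.inr ())) →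
      (Matrix.trace (R * Y1)).re ≤ (Matrix.trace (R * X1)).re) :
    ∀ i : Fin M, (1 / P) * (X1 i i).re =
      1 / 2 + 1 / 2 * X0 (Sum.inl i) (Sum.inr ()) := by
  intro i
  by_contra hne
  have hlt := lt_of_le_of_ne (hfeas i) hne
  set s : ℝ := 1 / 2 + 1 / 2 * X0 (Sum.inl i) (Sum.inr ()) - 1 / P * (X1 i i).re with hs
  have hε : 0 < P * s := mul_pos hP (by rw [hs]; linarith)
  have hpsd : (diagonal (Pi.single i ((P * s : ℝ) : ℂ))).PosSemidef := by
    refine PosSemidef.diagonal (Pi.single_nonneg.2 ?_)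
    exact_mod_cast hε.le
  have hdiag := (Complex.pos_iff.1 (hR.diag_pos (i := i))).1
  have hle := hopt X0 (X1 + diagonal (Pi.single i ((P * s : ℝ) : ℂ))) hX0symm hX0psd hX0diag
    hX0tr (hX1psd.add hpsd) fun j => by
      by_cases hj : j = i
      · subst hj
        rw [Matrix.add_apply, diagonal_apply_eq, Pi.single_eq_same, Complex.add_re,
          Complex.ofReal_re, mul_add, ← mul_assoc, one_div_mul_cancel hP.ne']
        linarith
      · simpa [hj] using hfeas j
  have htr : trace (R * diagonal (Pi.single i ((P * s : ℝ) : ℂ))) = R i i * ((P * s : ℝ) : ℂ) := by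
    simp only [trace, diag_apply, mul_diagonal]
    rw [Fintype.sum_eq_single i fun j hj => by simp [hj], Pi.single_eq_same]
  rw [mul_add, trace_add, Complex.add_re, htr, Complex.re_mul_ofReal] at hle
  linarith [mul_pos hdiag hε]
end
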